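/- Let n > 1 and let g_1, …, g_n : M^n → 𝔸 be continuous with compact support. If f ∈ C¹(M^n, 𝔸) has compact support and satisfies ∂̄_j f = g_j on M^n for j = 1, …, n, then f vanishes identically on the unbounded connected component of M^n ∖ (supp g_1 ∪ ⋯ ∪ supp g_n). -/

import Mathlib

open MeasureTheory

noncomputable section

/-- A real alternative `*`-algebra of finite dimension `> 1`, with a fixed
hypercomplex basis `v 0 = 1, v 1, …, v m` spanning the hypercomplex subspace `M`.
Multiplication is `ℝ`-bilinear (bundled as a linear map). -/
structure HCAlg (𝔸 : Type) [NormedAddCommGroup 𝔸] [NormedSpace ℝ 𝔸] (m : ℕ) : Type where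
  mul : 𝔸 →ₗ[ℝ] 𝔸 →ₗ[ℝ] 𝔸
  one : 𝔸
  conj : 𝔸 →ₗ[ℝ] 𝔸
  findim : FiniteDimensional ℝ 𝔸
  dim_gt_one : 1 < Module.finrank ℝ 𝔸
  one_mul' : ∀ a, mul one a = a
  mul_one' : ∀ a, mul a one = a
  alt_left : ∀ a b, mul a (mul a b) = mul (mul a a) b
  alt_right : ∀ a b, mul (mul b a) a = mul b (mul a a)
  conj_invol : ∀ a, conj (conj a) = a
  conj_mul' : ∀ a b, conj (mul a b) = mul (conj b) (conj a)
  conj_one : conj one = one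
  hm : 1 ≤ m
  v : Fin (m + 1) → 𝔸
  v_indep : LinearIndependent ℝ v
  v_zero : v 0 = one
  v_trace : ∀ s, s ≠ 0 → v s + conj (v s) = 0
  v_norm : ∀ s, s ≠ 0 → mul (v s) (conj (v s)) = one
  v_anticomm : ∀ s t, s ≠ 0 → t ≠ 0 → s ≠ t → mul (v s) (v t) = -(mul (v t) (v s))

variable {𝔸 : Type} [NormedAddCommGroup 𝔸] [NormedSpace ℝ 𝔸] {m n : ℕ}

/-- `M^n`, identified with `ℝ^{(m+1)n}` via the coordinates `x j s`. -/
abbrev Mn (n m : ℕ) := Fin n → Fin (m + 1) → ℝ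

/-- Euclidean norm of a point of `M` (in coordinates). -/
def enormM (c : Fin (m + 1) → ℝ) : ℝ := Real.sqrt (∑ s, c s ^ 2)

/-- Euclidean norm of a point of `M^n` (in coordinates). -/
def enormMn (x : Mn n m) : ℝ := Real.sqrt (∑ j, ∑ s, x j s ^ 2)

/-- Partial derivative `∂f/∂x_{j,s}` for functions on `M^n`. -/
def pd {E : Type} [NormedAddCommGroup E] [NormedSpace ℝ E]
    (f : Mn n m → E) (j : Fin n) (s : Fin (m + 1)) (x : Mn n m) : E :=
  fderiv ℝ f x (Pi.single j (Pi.single s 1))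

/-- Partial derivative `∂f/∂x_s` for functions on `M`. -/
def pd1 {E : Type} [NormedAddCommGroup E] [NormedSpace ℝ E]
    (f : (Fin (m + 1) → ℝ) → E) (s : Fin (m + 1)) (x : Fin (m + 1) → ℝ) : E :=
  fderiv ℝ f x (Pi.single s 1)

/-- The Dirac (Cauchy–Riemann) operator `∂̄_j = ∑_s v_s ∂/∂x_{j,s}`. -/
def dbar (H : HCAlg 𝔸 m) (f : Mn n m → 𝔸) (j : Fin n) (x : Mn n m) : 𝔸 :=
  ∑ s, H.mul (H.v s) (pd f j s x)

/-- The conjugated Dirac operator `∂_j = ∑_s v_s^c ∂/∂x_{j,s}`. -/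
def dconj (H : HCAlg 𝔸 m) (f : Mn n m → 𝔸) (j : Fin n) (x : Mn n m) : 𝔸 :=
  ∑ s, H.mul (H.conj (H.v s)) (pd f j s x)

/-- The Laplacian `Δ_j = ∑_s ∂²/∂x_{j,s}²` in the `j`-th block of variables. -/
def lap {E : Type} [NormedAddCommGroup E] [NormedSpace ℝ E]
    (f : Mn n m → E) (j : Fin n) (x : Mn n m) : E :=
  ∑ s, pd (pd f j s) j s x

/-- Surface area of the unit `(N-1)`-sphere in `ℝ^N`: `σ_N = 2 π^{N/2} / Γ(N/2)`. -/
def usigma (N : ℕ) : ℝ := 2 * Real.pi ^ ((N : ℝ) / 2) / Real.Gamma ((N : ℝ) / 2)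

/-- Embedding of coordinates into the hypercomplex subspace `M ⊆ 𝔸`. -/
def embM (H : HCAlg 𝔸 m) (c : Fin (m + 1) → ℝ) : 𝔸 := ∑ s, c s • H.v s

/-- The Cauchy kernel `E(x) = σ_{m+1}⁻¹ x^c / |x|^{m+1}` on `M`. -/
def CauchyE (H : HCAlg 𝔸 m) (c : Fin (m + 1) → ℝ) : 𝔸 :=
  (usigma (m + 1) * enormM c ^ (m + 1))⁻¹ • H.conj (embM H c)

/-- The Bochner–Martinelli kernel components `K_j(x) = σ_N⁻¹ x_j^c / |x|^N`, `N = (m+1)n`. -/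
def Kker (H : HCAlg 𝔸 m) (n : ℕ) (j : Fin n) (x : Mn n m) : 𝔸 :=
  (usigma ((m + 1) * n) * enormMn x ^ ((m + 1) * n))⁻¹ • H.conj (embM H (x j))

/-- `Tsol g (x) = −∫_M E(y₁ − x₁) (g(y₁, x⁰)) dV(y₁)`. -/
def Tsol (H : HCAlg 𝔸 m) (hn : 0 < n) (g : Mn n m → 𝔸) (x : Mn n m) : 𝔸 :=
  - ∫ y1 : Fin (m + 1) → ℝ,
      H.mul (CauchyE H (y1 - x ⟨0, hn⟩)) (g (Function.update x ⟨0, hn⟩ y1))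

/-- `Fint g (x) = ∫_M E(y₁) (g(y₁ + x₁, x⁰)) dV(y₁)`. -/
def Fint (H : HCAlg 𝔸 m) (hn : 0 < n) (g : Mn n m → 𝔸) (x : Mn n m) : 𝔸 :=
  ∫ y1 : Fin (m + 1) → ℝ,
      H.mul (CauchyE H y1) (g (Function.update x ⟨0, hn⟩ (y1 + x ⟨0, hn⟩)))



open scoped ContDiff

section RadialBump

/-- The squared Euclidean norm on `M^n`. -/
def sqNormMn (x : Mn n m) : ℝ := ∑ j, ∑ s, x j s ^ 2

lemma contDiff_sqNormMn : ContDiff ℝ ∞ (sqNormMn : Mn n m → ℝ) := by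
  unfold sqNormMn
  fun_prop

lemma pd_sqNormMn (x : Mn n m) (j : Fin n) (s : Fin (m + 1)) :
    pd sqNormMn j s x = 2 * x j s := by
  have h : HasFDerivAt (sqNormMn : Mn n m → ℝ)
      (∑ k, ∑ t, (2 * x k t) • (ContinuousLinearMap.proj (R := ℝ) t ∘L
        ContinuousLinearMap.proj (R := ℝ) (φ := fun _ : Fin n => Fin (m + 1) → ℝ) k)) x := by
    unfold sqNormMn
    refine HasFDerivAt.fun_sum fun k _ => HasFDerivAt.fun_sum fun t _ => ?_
    have h1 : HasFDerivAt (fun y : Mn n m => y k t) (ContinuousLinearMap.proj (R := ℝ) t ∘L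
        ContinuousLinearMap.proj (R := ℝ) (φ := fun _ : Fin n => Fin (m + 1) → ℝ) k) x :=
      (ContinuousLinearMap.proj (R := ℝ) (φ := fun _ : Fin (m + 1) => ℝ) t ∘L
        ContinuousLinearMap.proj (R := ℝ) (φ := fun _ : Fin n => Fin (m + 1) → ℝ) k).hasFDerivAt
    simpa using h1.pow 2
  rw [pd, h.fderiv]
  simp only [sum_apply, smul_apply,
    ContinuousLinearMap.comp_apply, ContinuousLinearMap.proj_apply, smul_eq_mul]
  rw [Finset.sum_eq_single j, Finset.sum_eq_single s] <;> simp +contextual [Pi.single_apply]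

lemma norm_le_one_of_sqNormMn_le_one {x : Mn n m} (hx : sqNormMn x ≤ 1) : ‖x‖ ≤ 1 := by
  refine (pi_norm_le_iff_of_nonneg zero_le_one).2 fun j =>
    (pi_norm_le_iff_of_nonneg zero_le_one).2 fun s => ?_
  have h : x j s ^ 2 ≤ 1 := by
    refine le_trans ?_ hx
    refine le_trans ?_ (Finset.single_le_sum (f := fun j => ∑ s, x j s ^ 2)
      (fun j _ => Finset.sum_nonneg fun s _ => sq_nonneg _) (Finset.mem_univ j))
    exact Finset.single_le_sum (f := fun s => x j s ^ 2) (fun s _ => sq_nonneg _)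
      (Finset.mem_univ s)
  exact (sq_le_one_iff_abs_le_one _).1 h

/-- A smooth nonnegative radial bump function on `M^n`, supported in the unit ball. -/
def radialBump (x : Mn n m) : ℝ :=
  2 * ((1 - sqNormMn x)⁻¹ ^ 2 * expNegInvGlue (1 - sqNormMn x))

/-- A smooth radial potential, whose gradient at `x` is `radialBump x` times `x`. -/
def radialPotential (x : Mn n m) : ℝ := -expNegInvGlue (1 - sqNormMn x)

lemma contDiff_radialBump : ContDiff ℝ ∞ (radialBump : Mn n m → ℝ) := by
  have h := (expNegInvGlue.contDiff_polynomial_eval_inv_mul (n := ⊤) (Polynomial.X ^ 2)).comp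
    ((contDiff_const (c := (1 : ℝ))).sub (contDiff_sqNormMn (n := n) (m := m)))
  simp only [Polynomial.eval_pow, Polynomial.eval_X] at h
  exact (contDiff_const (c := (2 : ℝ))).mul h

lemma contDiff_radialPotential : ContDiff ℝ ∞ (radialPotential : Mn n m → ℝ) :=
  (expNegInvGlue.contDiff.comp (contDiff_const.sub contDiff_sqNormMn)).neg

lemma pd_radialPotential (x : Mn n m) (j : Fin n) (s : Fin (m + 1)) :
    pd radialPotential j s x = radialBump x * x j s := by
  have h1 := expNegInvGlue.hasDerivAt_polynomial_eval_inv_mul 1 (1 - sqNormMn x)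
  simp only [Polynomial.eval_one, one_mul, Polynomial.derivative_one, sub_zero, mul_one,
    Polynomial.eval_pow, Polynomial.eval_X] at h1
  have h2 := ((contDiff_sqNormMn (n := n) (m := m)).differentiable (by simp) x).hasFDerivAt
  have h3 := (h1.comp_hasFDerivAt x (h2.const_sub 1)).neg
  have h4 : fderiv ℝ (radialPotential : Mn n m → ℝ) x = _ := h3.fderiv
  have h5 := pd_sqNormMn x j s
  rw [pd] at h5
  rw [pd, h4]
  simp [h5, radialBump]
  ring

lemma radialBump_neg (x : Mn n m) : radialBump (-x) = radialBump x := by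
  simp [radialBump, sqNormMn]

lemma tsupport_radialBump : tsupport (radialBump : Mn n m → ℝ) ⊆ Metric.closedBall 0 1 := by
  refine closure_minimal (fun x hx => ?_) Metric.isClosed_closedBall
  rw [mem_closedBall_zero_iff]
  refine norm_le_one_of_sqNormMn_le_one (not_lt.1 fun h => hx ?_)
  simp [radialBump, expNegInvGlue.zero_of_nonpos (sub_nonpos.2 h.le)]

lemma tsupport_radialPotential :
    tsupport (radialPotential : Mn n m → ℝ) ⊆ Metric.closedBall 0 1 := by
  refine closure_minimal (fun x hx => ?_) Metric.isClosed_closedBall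
  rw [mem_closedBall_zero_iff]
  refine norm_le_one_of_sqNormMn_le_one (not_lt.1 fun h => hx ?_)
  simp [radialPotential, expNegInvGlue.zero_of_nonpos (sub_nonpos.2 h.le)]

lemma hasCompactSupport_radialBump : HasCompactSupport (radialBump : Mn n m → ℝ) :=
  (isCompact_closedBall 0 1).of_isClosed_subset (isClosed_tsupport _) tsupport_radialBump

lemma hasCompactSupport_radialPotential : HasCompactSupport (radialPotential : Mn n m → ℝ) :=
  (isCompact_closedBall 0 1).of_isClosed_subset (isClosed_tsupport _) tsupport_radialPotential

lemma radialBump_integral_pos : 0 < ∫ x : Mn n m, radialBump x := by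
  refine contDiff_radialBump.continuous.integral_pos_of_hasCompactSupport_nonneg_nonzero
    hasCompactSupport_radialBump (x := 0) (fun x => ?_) ?_
  · exact mul_nonneg zero_le_two (mul_nonneg (sq_nonneg _) (expNegInvGlue.nonneg _))
  · simp [radialBump, sqNormMn]

end RadialBump

section IntegrationByParts

variable {E F : Type*} [NormedAddCommGroup E] [NormedSpace ℝ E] [NormedAddCommGroup F]
  [NormedSpace ℝ F]

lemma HasCompactSupport.fderiv_apply_const {u : E → F} (hu : HasCompactSupport u) (v : E) :
    HasCompactSupport fun y => fderiv ℝ u y v :=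
  hu.fderiv (𝕜 := ℝ) |>.comp_left (g := fun L : E →L[ℝ] F => L v) (by simp)

/-- Derivatives can be exchanged between the two factors of a product under the integral. -/
lemma integral_fderiv_smul_fderiv_comm [FiniteDimensional ℝ E] [MeasurableSpace E] [BorelSpace E]
    (μ : Measure E) [μ.IsAddHaarMeasure] {ψ : E → ℝ} {w : E → F} (hψ : ContDiff ℝ 2 ψ)
    (hψc : HasCompactSupport ψ) (hw : ContDiff ℝ 1 w) (a b : E) :
    ∫ y, fderiv ℝ ψ y a • fderiv ℝ w y b ∂μ = ∫ y, fderiv ℝ ψ y b • fderiv ℝ w y a ∂μ := by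
  have hd (a : E) : ContDiff ℝ 1 fun y => fderiv ℝ ψ y a :=
    (hψ.fderiv_right (m := 1) (by norm_num)).clm_apply contDiff_const
  have hdc (a : E) : HasCompactSupport fun y => fderiv ℝ ψ y a := hψc.fderiv_apply_const a
  have key (a b : E) : ∫ y, fderiv ℝ ψ y a • fderiv ℝ w y b ∂μ =
      -∫ y, fderiv ℝ (fun z => fderiv ℝ ψ z a) y b • w y ∂μ := by
    refine integral_smul_fderiv_eq_neg_fderiv_smul_of_integrable ?_ ?_ ?_
      (fun x _ => (hd a).differentiable one_ne_zero x)
      (fun x _ => hw.differentiable one_ne_zero x)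
    · refine Continuous.integrable_of_hasCompactSupport ?_
        ((hdc a).fderiv_apply_const b).smul_right
      exact (((hd a).continuous_fderiv one_ne_zero).clm_apply continuous_const).smul hw.continuous
    · refine Continuous.integrable_of_hasCompactSupport ?_ (hdc a).smul_right
      exact (hd a).continuous.smul
        ((hw.continuous_fderiv one_ne_zero).clm_apply continuous_const)
    · exact ((hd a).continuous.smul hw.continuous).integrable_of_hasCompactSupport
        (hdc a).smul_right
  rw [key a b, key b a]
  congr 2 with y
  have hsymm : IsSymmSndFDerivAt ℝ ψ y := hψ.contDiffAt.isSymmSndFDerivAt (by simp)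
  have hdd : DifferentiableAt ℝ (fderiv ℝ ψ) y :=
    (hψ.fderiv_right (m := 1) (by norm_num)).differentiable one_ne_zero y
  rw [fderiv_clm_apply hdd (differentiableAt_const a),
    fderiv_clm_apply hdd (differentiableAt_const b)]
  simp [hsymm.eq a b]

end IntegrationByParts

namespace HCAlg

lemma conj_v (H : HCAlg 𝔸 m) {s : Fin (m + 1)} (hs : s ≠ 0) : H.conj (H.v s) = -H.v s :=
  (neg_eq_of_add_eq_zero_right (H.v_trace s hs)).symm

lemma mul_self_v (H : HCAlg 𝔸 m) {s : Fin (m + 1)} (hs : s ≠ 0) :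
    H.mul (H.v s) (H.v s) = -H.one := by
  rw [← H.v_norm s hs, H.conj_v hs, map_neg, neg_neg]

lemma conj_v_mul_v_mul_self (H : HCAlg 𝔸 m) (s : Fin (m + 1)) (a : 𝔸) :
    H.mul (H.conj (H.v s)) (H.mul (H.v s) a) = a := by
  by_cases hs : s = 0
  · simp [hs, H.v_zero, H.conj_one, H.one_mul']
  · simp [H.conj_v hs, H.alt_left, H.mul_self_v hs, H.one_mul']

lemma mul_mul_add_mul_mul (H : HCAlg 𝔸 m) (x y a : 𝔸) :
    H.mul x (H.mul y a) + H.mul y (H.mul x a) = H.mul (H.mul x y + H.mul y x) a := by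
  have h := H.alt_left (x + y) a
  simp only [map_add, LinearMap.add_apply, H.alt_left x a, H.alt_left y a] at h ⊢
  have key (p q r s t u : 𝔸) (h : p + q + (r + s) = p + t + (u + s)) : r + q = u + t := by
    refine add_left_cancel (a := p + s) ?_
    calc _ = p + q + (r + s) := by abel
      _ = _ := h
      _ = _ := by abel
  exact key _ _ _ _ _ _ h

lemma conj_v_mul_v_mul_antisymm (H : HCAlg 𝔸 m) {s t : Fin (m + 1)} (hst : s ≠ t) (a : 𝔸) :
    H.mul (H.conj (H.v s)) (H.mul (H.v t) a) + H.mul (H.conj (H.v t)) (H.mul (H.v s) a) = 0 := by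
  by_cases hs : s = 0
  · subst hs
    simp [H.conj_v hst.symm, H.v_zero, H.conj_one, H.one_mul']
  by_cases ht : t = 0
  · subst ht
    simp [H.conj_v hst, H.v_zero, H.conj_one, H.one_mul']
  rw [H.conj_v hs, H.conj_v ht]
  have h := H.mul_mul_add_mul_mul (H.v s) (H.v t) a
  rw [H.v_anticomm s t hs ht hst, neg_add_cancel, map_zero, LinearMap.zero_apply] at h
  simp only [map_neg, LinearMap.neg_apply]
  rw [← neg_add, h, neg_zero]

lemma sum_conj_v_mul_v_mul (H : HCAlg 𝔸 m) (A : Fin (m + 1) → Fin (m + 1) → 𝔸)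
    (hA : ∀ s t, A s t = A t s) :
    ∑ s, ∑ t, H.mul (H.conj (H.v s)) (H.mul (H.v t) (A s t)) = ∑ s, A s s := by
  set B := fun s t => H.mul (H.conj (H.v s)) (H.mul (H.v t) (A s t)) with hB
  have h1 : ∀ s t, B s t + B t s = if s = t then (2 : ℝ) • A s s else 0 := by
    intro s t
    split_ifs with hst
    · subst hst
      simp [hB, H.conj_v_mul_v_mul_self, two_smul]
    · simp only [hB, hA t s]
      exact H.conj_v_mul_v_mul_antisymm hst _
  have h2 : (2 : ℝ) • ∑ s, ∑ t, B s t = (2 : ℝ) • ∑ s, A s s := by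
    calc _ = ∑ s, ∑ t, (B s t + B t s) := by
          simp only [Finset.sum_add_distrib, two_smul]
          rw [Finset.sum_comm (f := fun s t => B t s)]
      _ = _ := by simp [h1, Finset.smul_sum]
  exact smul_right_injective 𝔸 (two_ne_zero (α := ℝ)) h2

end HCAlg

section MeanValue

lemma fderiv_comp_const_sub_smul {u : Mn n m → 𝔸} (hu : ContDiff ℝ 1 u) (x : Mn n m) (ε : ℝ)
    (y b : Mn n m) :
    fderiv ℝ (fun y => u (x - ε • y)) y b = (-ε) • fderiv ℝ u (x - ε • y) b := by
  have h1 : HasFDerivAt (fun y : Mn n m => x - ε • y)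
      (-(ε • ContinuousLinearMap.id ℝ (Mn n m))) y :=
    ((hasFDerivAt_id y).const_smul ε).const_sub x
  have h2 := ((hu.differentiable one_ne_zero (x - ε • y)).hasFDerivAt.comp y h1).fderiv
  rw [Function.comp_def] at h2
  rw [h2]
  simp

lemma sum_integral_pd_smul_pd_eq_zero (H : HCAlg 𝔸 m) {u : Mn n m → 𝔸} (hu : ContDiff ℝ 1 u)
    (x : Mn n m) {ε : ℝ} (hε : ε ≠ 0) (j : Fin n)
    (hz : ∀ y ∈ Metric.closedBall 0 1, dbar H u j (x - ε • y) = 0) :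
    ∑ s, ∫ y : Mn n m, pd radialPotential j s y • pd u j s (x - ε • y) = 0 := by
  have := H.findim
  have := FiniteDimensional.complete ℝ 𝔸
  set e : Fin (m + 1) → Mn n m := fun s => Pi.single j (Pi.single s 1) with he
  set Ψ : Mn n m → ℝ := radialPotential
  set A : Fin (m + 1) → Fin (m + 1) → 𝔸 :=
    fun s t => ∫ y, pd Ψ j s y • pd u j t (x - ε • y) with hA
  have hΨ : ContDiff ℝ 2 Ψ := contDiff_infty.1 contDiff_radialPotential 2
  have hw : ContDiff ℝ 1 fun y => u (x - ε • y) := by fun_prop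
  have hsymm (s t) : A s t = A t s := by
    have h := integral_fderiv_smul_fderiv_comm volume hΨ hasCompactSupport_radialPotential hw
      (e s) (e t)
    simp only [fderiv_comp_const_sub_smul hu, smul_comm _ (-ε), integral_smul] at h
    exact smul_right_injective 𝔸 (neg_ne_zero.2 hε) h
  have hint (s t) : Integrable fun y => pd Ψ j s y • pd u j t (x - ε • y) := by
    refine Continuous.integrable_of_hasCompactSupport ?_
      (hasCompactSupport_radialPotential.fderiv_apply_const (e s)).smul_right
    refine ((hΨ.continuous_fderiv two_ne_zero).clm_apply continuous_const).smul ?_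
    exact ((hu.continuous_fderiv one_ne_zero).comp (by fun_prop)).clm_apply continuous_const
  rw [← H.sum_conj_v_mul_v_mul A hsymm]
  have hpull (s t) : H.mul (H.conj (H.v s)) (H.mul (H.v t) (A s t)) =
      ∫ y, H.mul (H.conj (H.v s)) (H.mul (H.v t) (pd Ψ j s y • pd u j t (x - ε • y))) :=
    (((H.mul (H.conj (H.v s))) ∘ₗ (H.mul (H.v t))).toContinuousLinearMap.integral_comp_comm
      (hint s t)).symm
  simp only [hpull]
  have hint' (s t) : Integrable fun y =>
      H.mul (H.conj (H.v s)) (H.mul (H.v t) (pd Ψ j s y • pd u j t (x - ε • y))) :=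
    ((H.mul (H.conj (H.v s))) ∘ₗ (H.mul (H.v t))).toContinuousLinearMap.integrable_comp (hint s t)
  simp only [← integral_finsetSum _ fun t _ => hint' _ t]
  refine Finset.sum_eq_zero fun s _ => integral_eq_zero_of_ae (.of_forall fun y => ?_)
  simp only [map_smul, ← Finset.smul_sum, ← map_sum, Pi.zero_apply]
  by_cases hy : y ∈ tsupport Ψ
  · have := hz y (tsupport_radialPotential hy)
    rw [dbar] at this
    rw [this, map_zero, smul_zero]
  · have : pd Ψ j s y = 0 := by
      rw [pd, image_eq_zero_of_notMem_tsupport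
        (fun h => hy (tsupport_fderiv_subset ℝ h)), zero_apply]
    rw [this, zero_smul]

lemma fderiv_apply_eq_sum_pd {E : Type} [NormedAddCommGroup E] [NormedSpace ℝ E]
    (u : Mn n m → E) (x y : Mn n m) :
    fderiv ℝ u x y = ∑ j, ∑ s, y j s • pd u j s x := by
  have hy : y = ∑ j, ∑ s, y j s • (Pi.single j (Pi.single s 1) : Mn n m) := by
    ext k t
    simp only [Finset.sum_apply, Pi.smul_apply, smul_eq_mul]
    rw [Finset.sum_eq_single k, Finset.sum_eq_single t] <;> simp +contextual [Pi.single_apply]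
  conv_lhs => rw [hy]
  simp [pd]

lemma hasDerivAt_integral_radialBump_smul {u : Mn n m → 𝔸} (hu : ContDiff ℝ 1 u)
    (huc : HasCompactSupport u) (x : Mn n m) (ε : ℝ) :
    HasDerivAt (fun ε : ℝ => ∫ y : Mn n m, radialBump y • u (x - ε • y))
      (-∫ y : Mn n m, radialBump y • fderiv ℝ u (x - ε • y) y) ε := by
  obtain ⟨C, hC⟩ := (hu.continuous_fderiv one_ne_zero).bounded_above_of_compact_support
    (huc.fderiv (𝕜 := ℝ))
  have hφ : Continuous (radialBump : Mn n m → ℝ) := contDiff_radialBump.continuous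
  have hcont (ε : ℝ) : Continuous fun y : Mn n m => radialBump y • u (x - ε • y) :=
    hφ.smul (hu.continuous.comp (by fun_prop))
  have hcont' : Continuous fun y : Mn n m => -(radialBump y • fderiv ℝ u (x - ε • y) y) :=
    (hφ.smul (((hu.continuous_fderiv one_ne_zero).comp (by fun_prop)).clm_apply
      continuous_id)).neg
  rw [← integral_neg]
  refine (hasDerivAt_integral_of_dominated_loc_of_deriv_le
    (F' := fun ε y => -(radialBump y • fderiv ℝ u (x - ε • y) y))
    (bound := fun y : Mn n m => |radialBump y| * (C * ‖y‖)) Filter.univ_mem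
    (.of_forall fun ε => (hcont ε).aestronglyMeasurable)
    ((hcont ε).integrable_of_hasCompactSupport hasCompactSupport_radialBump.smul_right)
    hcont'.aestronglyMeasurable (.of_forall fun y δ _ => ?_) ?_
    (.of_forall fun y δ _ => ?_)).2
  · rw [norm_neg, norm_smul, Real.norm_eq_abs]
    gcongr
    exact (fderiv ℝ u _).le_of_opNorm_le (hC _) y
  · refine Continuous.integrable_of_hasCompactSupport (by fun_prop) ?_
    exact (hasCompactSupport_radialBump.comp_left (g := fun t : ℝ => |t|) abs_zero).mul_right
  · have h1 : HasDerivAt (fun δ : ℝ => x - δ • y) (-y) δ := by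
      simpa using ((hasDerivAt_id δ).smul_const y).const_sub x
    have h2 := (hu.differentiable one_ne_zero (x - δ • y)).hasFDerivAt.comp_hasDerivAt δ h1
    simpa [Function.comp_def] using h2.fun_const_smul (radialBump y)

/-- The mean value property for solutions of the homogeneous system. -/
lemma integral_radialBump_smul_eq (H : HCAlg 𝔸 m) {u : Mn n m → 𝔸} (hu : ContDiff ℝ 1 u)
    (huc : HasCompactSupport u) {x : Mn n m} {ρ : ℝ} (hρ : 0 ≤ ρ)
    (hz : ∀ y ∈ Metric.closedBall x ρ, ∀ j, dbar H u j y = 0) :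
    ∫ y : Mn n m, radialBump y • u (x - ρ • y) = (∫ y : Mn n m, radialBump y) • u x := by
  have := H.findim
  have := FiniteDimensional.complete ℝ 𝔸
  have hder := hasDerivAt_integral_radialBump_smul hu huc x
  have hzero (ε : ℝ) (hε : ε ∈ Set.Ico 0 ρ) :
      ∫ y : Mn n m, radialBump y • fderiv ℝ u (x - ε • y) y = 0 := by
    rcases eq_or_ne ε 0 with rfl | hε0
    · have h := integral_neg_eq_self
        (fun y : Mn n m => radialBump y • fderiv ℝ u (x - (0 : ℝ) • y) y) volume
      simp only [radialBump_neg, zero_smul, neg_zero, map_neg, smul_neg, integral_neg] at h ⊢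
      have := IsAddTorsionFree.of_isTorsionFree ℝ 𝔸
      exact self_eq_neg.1 h.symm
    · have hint (j : Fin n) (s : Fin (m + 1)) :
          Integrable fun y => pd radialPotential j s y • pd u j s (x - ε • y) := by
        refine Continuous.integrable_of_hasCompactSupport ?_
          (hasCompactSupport_radialPotential.fderiv_apply_const _).smul_right
        refine ((contDiff_radialPotential.continuous_fderiv (by simp)).clm_apply
          continuous_const).smul ?_
        exact ((hu.continuous_fderiv one_ne_zero).comp (by fun_prop)).clm_apply continuous_const
      have heq : (fun y : Mn n m => radialBump y • fderiv ℝ u (x - ε • y) y) =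
          fun y => ∑ j, ∑ s, pd radialPotential j s y • pd u j s (x - ε • y) := by
        ext1 y
        simp only [fderiv_apply_eq_sum_pd u _ y, Finset.smul_sum, pd_radialPotential, mul_smul]
      rw [heq, integral_finsetSum _ fun j _ => integrable_finsetSum _ fun s _ => hint j s]
      refine Finset.sum_eq_zero fun j _ => ?_
      rw [integral_finsetSum _ fun s _ => hint j s]
      refine sum_integral_pd_smul_pd_eq_zero H hu x hε0 j fun y hy => hz _ ?_ j
      rw [mem_closedBall_zero_iff] at hy
      rw [mem_closedBall_iff_norm, sub_sub_cancel_left, norm_neg, norm_smul, Real.norm_eq_abs,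
        abs_of_nonneg hε.1]
      exact (mul_le_of_le_one_right hε.1 hy).trans hε.2.le
  have h := constant_of_has_deriv_right_zero (a := 0) (b := ρ)
    (fun ε _ => (hder ε).continuousAt.continuousWithinAt)
    (fun ε hε => by simpa [hzero ε hε] using (hder ε).hasDerivWithinAt) ρ ⟨hρ, le_rfl⟩
  simpa [integral_smul_const] using h

end MeanValue

section Smoothing

open scoped Convolution

/-- A solution of the inhomogeneous system agrees with a smooth function at all points that are
far from the supports of the right-hand sides. -/
lemma exists_contDiff_eq_of_dbar_eq_zero (H : HCAlg 𝔸 m) {f : Mn n m → 𝔸} (hf : ContDiff ℝ 1 f)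
    (hfc : HasCompactSupport f) {ρ : ℝ} (hρ : 0 < ρ) :
    ∃ u : Mn n m → 𝔸, ContDiff ℝ ∞ u ∧ HasCompactSupport u ∧
      ∀ x, (∀ y ∈ Metric.closedBall x ρ, ∀ j, dbar H f j y = 0) → u x = f x := by
  set c : ℝ := ∫ y : Mn n m, radialBump y with hc
  have hc0 : c ≠ 0 := radialBump_integral_pos.ne'
  set φ : Mn n m → ℝ := fun y => radialBump (ρ⁻¹ • y) with hφ
  have hφs : ContDiff ℝ ∞ φ := contDiff_radialBump.comp (contDiff_const_smul _)
  have hφc : HasCompactSupport φ := hasCompactSupport_radialBump.comp_smul (inv_ne_zero hρ.ne')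
  set L := ContinuousLinearMap.lsmul ℝ ℝ (E := 𝔸)
  set r : ℝ := |(ρ ^ Module.finrank ℝ (Mn n m))⁻¹| with hr
  refine ⟨fun x => (c⁻¹ * r) • (φ ⋆[L, volume] f) x, ?_, ?_, fun x hx => ?_⟩
  · exact contDiff_const.smul
      (hφc.contDiff_convolution_left L hφs hf.continuous.locallyIntegrable)
  · exact (hφc.convolution L hfc).smul_left (f := fun _ => c⁻¹ * r)
  · have h1 := integral_radialBump_smul_eq H hf hfc hρ.le hx
    have h2 := Measure.integral_comp_smul volume (fun z => φ z • f (x - z)) ρ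
    simp only [hφ, inv_smul_smul₀ hρ.ne'] at h2
    rw [h1] at h2
    change (c⁻¹ * r) • (φ ⋆[L, volume] f) x = f x
    rw [mul_smul]
    refine (congrArg (c⁻¹ • ·) h2.symm).trans ?_
    rw [← hc, inv_smul_smul₀ hc0]

end Smoothing

section CauchyEstimates

/-- The derivative of `u` in the direction `v`. -/
def dirDeriv (v : Mn n m) (u : Mn n m → 𝔸) (x : Mn n m) : 𝔸 := fderiv ℝ u x v

lemma contDiff_dirDeriv {u : Mn n m → 𝔸} (hu : ContDiff ℝ ∞ u) (v : Mn n m) :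
    ContDiff ℝ ∞ (dirDeriv v u) :=
  (hu.fderiv_right (m := ∞) (by simp)).clm_apply contDiff_const

lemma dbar_dirDeriv (H : HCAlg 𝔸 m) {u : Mn n m → 𝔸} (hu : ContDiff ℝ ∞ u) (v : Mn n m)
    (j : Fin n) (x : Mn n m) : dbar H (dirDeriv v u) j x = dirDeriv v (dbar H u j) x := by
  have := H.findim
  have hsymm : IsSymmSndFDerivAt ℝ u x :=
    (contDiff_infty.1 hu 2).contDiffAt.isSymmSndFDerivAt (by simp)
  have hdd : DifferentiableAt ℝ (fderiv ℝ u) x :=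
    (hu.fderiv_right (m := ∞) (by simp)).differentiable (by simp) x
  have hcomm (a b : Mn n m) :
      fderiv ℝ (fun y => fderiv ℝ u y a) x b = fderiv ℝ (fun y => fderiv ℝ u y b) x a := by
    rw [fderiv_clm_apply hdd (differentiableAt_const a),
      fderiv_clm_apply hdd (differentiableAt_const b)]
    simp [hsymm.eq a b]
  have hsum : HasFDerivAt (dbar H u j) (∑ s, (H.mul (H.v s)).toContinuousLinearMap ∘L
      fderiv ℝ (fun y => fderiv ℝ u y (Pi.single j (Pi.single s 1))) x) x := by
    unfold dbar
    refine HasFDerivAt.fun_sum fun s _ => ?_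
    exact (H.mul (H.v s)).toContinuousLinearMap.hasFDerivAt.comp x
      (hdd.clm_apply (differentiableAt_const _)).hasFDerivAt
  rw [dirDeriv, hsum.fderiv, dbar]
  simp only [sum_apply]
  refine Finset.sum_congr rfl fun s _ => ?_
  exact congrArg (H.mul (H.v s)) (hcomm v _)

lemma dbar_dirDeriv_eq_zero (H : HCAlg 𝔸 m) {u : Mn n m → 𝔸} (hu : ContDiff ℝ ∞ u)
    (v : Mn n m) {V : Set (Mn n m)} (hV : IsOpen V) (hz : ∀ y ∈ V, ∀ j, dbar H u j y = 0) :
    ∀ y ∈ V, ∀ j, dbar H (dirDeriv v u) j y = 0 := by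
  intro y hy j
  have h : dbar H u j =ᶠ[nhds y] fun _ => 0 :=
    Filter.eventually_of_mem (hV.mem_nhds hy) fun z hz' => hz z hz' j
  rw [dbar_dirDeriv H hu, dirDeriv, h.fderiv_eq]
  simp

/-- The constant in the gradient estimate for solutions of the homogeneous system on `M^n`. -/
def gradientConst (n m : ℕ) : ℝ :=
  (∫ y : Mn n m, radialBump y)⁻¹ * ∫ y : Mn n m, ‖fderiv ℝ (radialBump : Mn n m → ℝ) y‖

lemma gradientConst_nonneg (n m : ℕ) : 0 ≤ gradientConst n m :=
  mul_nonneg (inv_nonneg.2 radialBump_integral_pos.le) (integral_nonneg fun _ => norm_nonneg _)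

lemma norm_dirDeriv_le (H : HCAlg 𝔸 m) {u : Mn n m → 𝔸} (hu : ContDiff ℝ ∞ u)
    (huc : HasCompactSupport u) (v : Mn n m) {V : Set (Mn n m)} (hV : IsOpen V)
    (hz : ∀ y ∈ V, ∀ j, dbar H u j y = 0) {x : Mn n m} {ρ M : ℝ} (hρ : 0 < ρ)
    (hxV : Metric.closedBall x ρ ⊆ V) (hM : ∀ y ∈ Metric.closedBall x ρ, ‖u y‖ ≤ M) :
    ‖dirDeriv v u x‖ ≤ gradientConst n m * ‖v‖ / ρ * M := by
  set c : ℝ := ∫ y : Mn n m, radialBump y with hc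
  have hc0 : 0 < c := radialBump_integral_pos
  have hu1 : ContDiff ℝ 1 u := contDiff_infty.1 hu 1
  have hφ1 : ContDiff ℝ 1 (radialBump : Mn n m → ℝ) := contDiff_infty.1 contDiff_radialBump 1
  have hφc := hasCompactSupport_radialBump (n := n) (m := m)
  have hw : ContDiff ℝ 1 fun y => u (x - ρ • y) := by fun_prop
  have h1 := integral_radialBump_smul_eq H (contDiff_infty.1 (contDiff_dirDeriv hu v) 1)
    (huc.fderiv_apply_const v) hρ.le
    fun y hy => dbar_dirDeriv_eq_zero H hu v hV hz y (hxV hy)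
  have h2 : ∫ y : Mn n m, radialBump y • fderiv ℝ (fun y => u (x - ρ • y)) y v =
      -∫ y : Mn n m, fderiv ℝ radialBump y v • u (x - ρ • y) := by
    refine integral_smul_fderiv_eq_neg_fderiv_smul_of_integrable ?_ ?_ ?_
      (fun y _ => hφ1.differentiable one_ne_zero y) (fun y _ => hw.differentiable one_ne_zero y)
    · refine Continuous.integrable_of_hasCompactSupport ?_ (hφc.fderiv_apply_const v).smul_right
      exact ((hφ1.continuous_fderiv one_ne_zero).clm_apply continuous_const).smul hw.continuous
    · refine Continuous.integrable_of_hasCompactSupport ?_ hφc.smul_right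
      exact hφ1.continuous.smul
        ((hw.continuous_fderiv one_ne_zero).clm_apply continuous_const)
    · exact (hφ1.continuous.smul hw.continuous).integrable_of_hasCompactSupport hφc.smul_right
  simp only [fderiv_comp_const_sub_smul hu1, smul_comm _ (-ρ), integral_smul] at h2
  have h3 : (ρ * c) • dirDeriv v u x = ∫ y : Mn n m, fderiv ℝ radialBump y v • u (x - ρ • y) := by
    rw [mul_smul, hc, ← h1, ← neg_inj, ← neg_smul]
    exact h2
  have hbound (y : Mn n m) : ‖fderiv ℝ radialBump y v • u (x - ρ • y)‖ ≤
      ‖fderiv ℝ (radialBump : Mn n m → ℝ) y‖ * (‖v‖ * M) := by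
    by_cases hy : y ∈ tsupport (radialBump : Mn n m → ℝ)
    · have hy1 := mem_closedBall_zero_iff.1 (tsupport_radialBump hy)
      have hmem : x - ρ • y ∈ Metric.closedBall x ρ := by
        rw [mem_closedBall_iff_norm, sub_sub_cancel_left, norm_neg, norm_smul, Real.norm_eq_abs,
          abs_of_pos hρ]
        exact mul_le_of_le_one_right hρ.le hy1
      rw [norm_smul, ← mul_assoc]
      gcongr
      · exact ContinuousLinearMap.le_opNorm _ _
      · exact hM _ hmem
    · rw [image_eq_zero_of_notMem_tsupport (fun h => hy (tsupport_fderiv_subset ℝ h))]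
      simp
  have h4 : ‖∫ y : Mn n m, fderiv ℝ radialBump y v • u (x - ρ • y)‖ ≤
      (∫ y : Mn n m, ‖fderiv ℝ (radialBump : Mn n m → ℝ) y‖) * (‖v‖ * M) := by
    rw [← integral_mul_const]
    refine norm_integral_le_of_norm_le ?_ (.of_forall hbound)
    refine Integrable.mul_const ?_ _
    exact (hφ1.continuous_fderiv one_ne_zero).norm.integrable_of_hasCompactSupport
      (hφc.fderiv (𝕜 := ℝ)).norm
  rw [← h3, norm_smul, Real.norm_eq_abs, abs_of_pos (mul_pos hρ hc0)] at h4
  rw [gradientConst, ← hc]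
  have h5 : ∀ I : ℝ, c⁻¹ * I * ‖v‖ / ρ * M = (I * (‖v‖ * M)) / (ρ * c) := by
    intro I
    field_simp
  rw [h5, le_div_iff₀ (mul_pos hρ hc0), mul_comm]
  exact h4

lemma norm_iterate_dirDeriv_le (H : HCAlg 𝔸 m) (v : Mn n m) {V : Set (Mn n m)} (hV : IsOpen V)
    {x : Mn n m} {ρ : ℝ} (hρ : 0 < ρ) (k : ℕ) {u : Mn n m → 𝔸} (hu : ContDiff ℝ ∞ u)
    (huc : HasCompactSupport u) (hz : ∀ y ∈ V, ∀ j, dbar H u j y = 0)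
    (hxV : Metric.closedBall x (k * ρ) ⊆ V) {M : ℝ}
    (hM : ∀ y ∈ Metric.closedBall x (k * ρ), ‖u y‖ ≤ M) :
    ‖(dirDeriv v)^[k] u x‖ ≤ (gradientConst n m * ‖v‖ / ρ) ^ k * M := by
  induction k generalizing u M with
  | zero => simpa using hM x (by simp)
  | succ k ih =>
    have hsub {y : Mn n m} (hy : y ∈ Metric.closedBall x (k * ρ)) :
        Metric.closedBall y ρ ⊆ Metric.closedBall x ((k + 1 : ℕ) * ρ) := by
      refine Metric.closedBall_subset_closedBall' ?_
      rw [Metric.mem_closedBall] at hy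
      push_cast
      linarith
    rw [Function.iterate_succ_apply, pow_succ, mul_assoc]
    refine ih (contDiff_dirDeriv hu v) (huc.fderiv_apply_const v)
      (dbar_dirDeriv_eq_zero H hu v hV hz)
      ((Metric.closedBall_subset_closedBall (by gcongr; simp)).trans hxV) fun y hy => ?_
    exact norm_dirDeriv_le H hu huc v hV hz hρ ((hsub hy).trans hxV) fun z hz' => hM z (hsub hy hz')

end CauchyEstimates

section UniqueContinuation

lemma norm_le_pow_div_factorial (v x : Mn n m) {B : ℝ} (k : ℕ) {u : Mn n m → 𝔸}
    (hu : ContDiff ℝ ∞ u) (hx : ∀ i < k, (dirDeriv v)^[i] u x = 0)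
    (hB : ∀ t ∈ Set.Icc (0 : ℝ) 1, ‖(dirDeriv v)^[k] u (x + t • v)‖ ≤ B) :
    ∀ t ∈ Set.Icc (0 : ℝ) 1, ‖u (x + t • v)‖ ≤ B * t ^ k / k.factorial := by
  induction k generalizing u with
  | zero => simpa using hB
  | succ k ih =>
    have hd := ih (contDiff_dirDeriv hu v)
      (fun i hi => by simpa using hx (i + 1) (Nat.succ_lt_succ hi)) (by simpa using hB)
    have hder (t : ℝ) : HasDerivAt (fun t : ℝ => u (x + t • v)) (dirDeriv v u (x + t • v)) t := by
      have h1 : HasDerivAt (fun t : ℝ => x + t • v) v t := by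
        simpa using ((hasDerivAt_id t).smul_const v).const_add x
      exact (hu.differentiable (by simp) (x + t • v)).hasFDerivAt.comp_hasDerivAt t h1
    have hder' (t : ℝ) : HasDerivAt (fun t : ℝ => B * t ^ (k + 1) / (k + 1).factorial)
        (B * t ^ k / k.factorial) t := by
      refine (((hasDerivAt_pow (k + 1) t).const_mul B).div_const _).congr_deriv ?_
      rw [Nat.factorial_succ]
      push_cast
      field_simp
    refine fun t ht => image_norm_le_of_norm_deriv_right_le_deriv_boundary
      (fun t _ => (hder t).continuousAt.continuousWithinAt)
      (fun t _ => (hder t).hasDerivWithinAt) ?_ hder'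
      (fun t ht => hd t ⟨ht.1, ht.2.le⟩) ht
    simpa using hx 0 k.succ_pos

lemma iterate_dirDeriv_eventuallyEq_zero (v : Mn n m) {x : Mn n m} {u : Mn n m → 𝔸}
    (hx : u =ᶠ[nhds x] 0) (i : ℕ) : (dirDeriv v)^[i] u =ᶠ[nhds x] 0 := by
  induction i with
  | zero => exact hx
  | succ i ih =>
    rw [Function.iterate_succ_apply']
    refine (ih.fderiv (𝕜 := ℝ)).mono fun y hy => ?_
    rw [dirDeriv, hy]
    simp

lemma eq_zero_of_eventuallyEq_zero_of_contDiff (H : HCAlg 𝔸 m) {u : Mn n m → 𝔸}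
    (hu : ContDiff ℝ ∞ u) (huc : HasCompactSupport u) {x v : Mn n m} {R : ℝ} (hR : 0 < R)
    (hz : ∀ y ∈ Metric.ball x R, ∀ j, dbar H u j y = 0) (hx : u =ᶠ[nhds x] 0)
    (hv : (4 * gradientConst n m * Real.exp 1 + 2) * ‖v‖ < R) : u (x + v) = 0 := by
  have hC := gradientConst_nonneg n m
  set C := gradientConst n m
  obtain ⟨M, hM⟩ := hu.continuous.bounded_above_of_compact_support huc
  have hM0 : 0 ≤ M := (norm_nonneg _).trans (hM x)
  have hCv : 0 ≤ 4 * C * Real.exp 1 * ‖v‖ := by positivity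
  set q : ℝ := 4 * C * Real.exp 1 * ‖v‖ / R with hq
  have hq0 : 0 ≤ q := by positivity
  have hq1 : q < 1 := by
    rw [hq, div_lt_one hR]
    nlinarith [norm_nonneg v]
  have hv2 : ‖v‖ < R / 2 := by nlinarith [norm_nonneg v]
  have key (k : ℕ) (hk : k ≠ 0) : ‖u (x + v)‖ ≤ q ^ k * M := by
    have hk0 : (0 : ℝ) < k := by exact_mod_cast Nat.pos_of_ne_zero hk
    have hB (t : ℝ) (ht : t ∈ Set.Icc (0 : ℝ) 1) :
        ‖(dirDeriv v)^[k] u (x + t • v)‖ ≤ (C * ‖v‖ / (R / (4 * k))) ^ k * M := by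
      refine norm_iterate_dirDeriv_le H v Metric.isOpen_ball (by positivity) k hu huc hz ?_
        fun y _ => hM y
      refine Metric.closedBall_subset_ball' ?_
      have h1 : ‖t • v‖ ≤ ‖v‖ := by
        rw [norm_smul, Real.norm_eq_abs, abs_of_nonneg ht.1]
        exact mul_le_of_le_one_left (norm_nonneg v) ht.2
      have h2 : (k : ℝ) * (R / (4 * k)) = R / 4 := by field_simp
      rw [dist_eq_norm, add_sub_cancel_left, h2]
      linarith
    have h := norm_le_pow_div_factorial v x k hu
      (fun i _ => (iterate_dirDeriv_eventuallyEq_zero v hx i).self_of_nhds) hB 1 (by simp)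
    rw [one_smul, one_pow, mul_one] at h
    refine h.trans ?_
    have h3 : (k : ℝ) ^ k / k.factorial ≤ Real.exp 1 ^ k := by
      rw [← Real.exp_nat_mul, mul_one]
      exact Real.pow_div_factorial_le_exp (k : ℝ) hk0.le k
    calc _ = (4 * C * ‖v‖ / R) ^ k * M * ((k : ℝ) ^ k / k.factorial) := by
          have : C * ‖v‖ / (R / (4 * k)) = 4 * C * ‖v‖ / R * k := by field_simp
          rw [this, mul_pow]
          ring
      _ ≤ (4 * C * ‖v‖ / R) ^ k * M * Real.exp 1 ^ k := by gcongr
      _ = q ^ k * M := by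
          rw [mul_right_comm, ← mul_pow, hq]
          ring
  have hlim : Filter.Tendsto (fun k : ℕ => q ^ k * M) Filter.atTop (nhds 0) := by
    simpa using (tendsto_pow_atTop_nhds_zero_of_lt_one hq0 hq1).mul_const M
  have := ge_of_tendsto hlim ((Filter.eventually_ne_atTop 0).mono key)
  exact norm_le_zero_iff.1 this

lemma eq_zero_of_eventuallyEq_zero (H : HCAlg 𝔸 m) {f : Mn n m → 𝔸} (hf : ContDiff ℝ 1 f)
    (hfc : HasCompactSupport f) {x v : Mn n m} {R : ℝ} (hR : 0 < R)
    (hz : ∀ y ∈ Metric.ball x R, ∀ j, dbar H f j y = 0) (hx : f =ᶠ[nhds x] 0)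
    (hv : (4 * gradientConst n m * Real.exp 1 + 2) * ‖v‖ < R / 2) : f (x + v) = 0 := by
  obtain ⟨u, hu, huc, huf⟩ := exists_contDiff_eq_of_dbar_eq_zero H hf hfc (half_pos (half_pos hR))
  have heq : ∀ y ∈ Metric.ball x (R / 2), u y = f y := fun y hy =>
    huf y fun z hzy => hz z <| Metric.closedBall_subset_ball'
      (by rw [Metric.mem_ball] at hy; linarith) hzy
  have hev {y : Mn n m} (hy : y ∈ Metric.ball x (R / 2)) : u =ᶠ[nhds y] f :=
    Filter.eventually_of_mem (Metric.isOpen_ball.mem_nhds hy) heq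
  have hvR : ‖v‖ < R / 2 := by
    have := mul_nonneg (mul_nonneg (gradientConst_nonneg n m) (Real.exp_pos 1).le) (norm_nonneg v)
    nlinarith [norm_nonneg v]
  rw [← heq (x + v) (by simpa using hvR)]
  refine eq_zero_of_eventuallyEq_zero_of_contDiff H hu huc (half_pos hR) (fun y hy j => ?_)
    ((hev (Metric.mem_ball_self (half_pos hR))).trans hx) hv
  rw [← hz y (Metric.ball_subset_ball (by linarith) hy) j]
  simp only [dbar, pd, (hev hy).fderiv_eq]

/-- Unique continuation for solutions of the homogeneous system. -/
lemma eqOn_zero_of_isPreconnected (H : HCAlg 𝔸 m) {f : Mn n m → 𝔸} (hf : ContDiff ℝ 1 f)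
    (hfc : HasCompactSupport f) {U S : Set (Mn n m)} (hU : IsOpen U)
    (hz : ∀ y ∈ U, ∀ j, dbar H f j y = 0) (hS : IsPreconnected S) (hSU : S ⊆ U)
    (hne : ∃ p ∈ S, f =ᶠ[nhds p] 0) : ∀ x ∈ S, f x = 0 := by
  set K : ℝ := 4 * gradientConst n m * Real.exp 1 + 2 with hK
  have hK2 : 2 ≤ K := by
    have := mul_nonneg (gradientConst_nonneg n m) (Real.exp_pos 1).le
    linarith
  suffices S ⊆ {x | f =ᶠ[nhds x] 0} from fun x hx => (this hx).self_of_nhds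
  refine hS.subset_of_closure_inter_subset isOpen_setOfPred_eventually_nhds hne ?_
  rintro x ⟨hxc, hxS⟩
  obtain ⟨R, hR, hball⟩ := Metric.isOpen_iff.1 hU x (hSU hxS)
  have hδ : 0 < R / (8 * K) := by positivity
  have hδR : R / (8 * K) < R / 2 := by
    rw [div_lt_div_iff₀ (by positivity) two_pos]
    nlinarith
  obtain ⟨z, hzf, hxz⟩ := Metric.mem_closure_iff.1 hxc _ hδ
  refine Filter.eventually_of_mem (Metric.ball_mem_nhds x hδ) fun y hy => ?_
  have hyz : ‖y - z‖ < 2 * (R / (8 * K)) := by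
    rw [← dist_eq_norm]
    rw [Metric.mem_ball] at hy
    linarith [dist_triangle y x z]
  have h := eq_zero_of_eventuallyEq_zero H hf hfc (x := z) (v := y - z) (half_pos hR)
    (fun w hw => hz w (hball (Metric.ball_subset_ball' (by rw [dist_comm]; linarith) hw))) hzf ?_
  · simpa using h
  · calc K * ‖y - z‖ < K * (2 * (R / (8 * K))) := by gcongr
      _ = R / 2 / 2 := by
        field_simp
        norm_num

end UniqueContinuation

/-- If `f ∈ C¹(M^n, 𝔸)` has compact support and solves `∂̄_j f = g_j` with all `g_j`
continuous and compactly supported, then `f` vanishes identically on the unbounded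
connected component of `M^n ∖ (supp g₁ ∪ ⋯ ∪ supp g_n)`. -/
theorem solution_vanishes_on_unbounded_component (H : HCAlg 𝔸 m) (hn : 1 < n)
    (g : Fin n → Mn n m → 𝔸)
    (hgc : ∀ j, Continuous (g j)) (hgs : ∀ j, HasCompactSupport (g j))
    (f : Mn n m → 𝔸) (hf : ContDiff ℝ 1 f) (hfs : HasCompactSupport f)
    (hsol : ∀ (j : Fin n) (x : Mn n m), dbar H f j x = g j x) :
    ∀ x ∈ (⋃ j, tsupport (g j))ᶜ,
      ¬ Bornology.IsBounded (connectedComponentIn ((⋃ j, tsupport (g j))ᶜ) x) → f x = 0 := by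
  intro x hx hunb
  set U : Set (Mn n m) := (⋃ j, tsupport (g j))ᶜ
  have hU : IsOpen U := (isClosed_iUnion_of_finite fun j => isClosed_tsupport (g j)).isOpen_compl
  have hz : ∀ y ∈ U, ∀ j, dbar H f j y = 0 := fun y hy j => by
    rw [hsol]
    exact image_eq_zero_of_notMem_tsupport fun h => hy (Set.mem_iUnion_of_mem j h)
  have hne : ∃ p ∈ connectedComponentIn U x, f =ᶠ[nhds p] 0 := by
    obtain ⟨p, hp, hpf⟩ := Set.not_subset.1 fun h => hunb (hfs.isBounded.subset h)
    exact ⟨p, hp, notMem_tsupport_iff_eventuallyEq.1 hpf⟩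
  exact eqOn_zero_of_isPreconnected H hf hfs hU hz isPreconnected_connectedComponentIn
    (connectedComponentIn_subset U x) hne x (mem_connectedComponentIn hx)

end
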